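/- For all n ≥ 2, there is no 1-resilient lock-free strongly linearizable implementation of a max-register in an asynchronous message-passing system of n processes. -/

import Mathlib

/-!
A model of asynchronous message-passing systems with `n` processes, following
Fischer–Lynch–Paterson: in a step `(p, m)` process `p` receives message `m`
(`none` if no message), changes its local state, and sends a finite set of messages.
Object implementations encode invocations and responses of operations as changes
of the state of the invoking process.
-/

namespace MP

/-- A step `(p, m)`: process `p` takes a step in which it attempts to receive a
message; it receives `m`, where `m = none` means it receives no message. -/
abbrev Step (n : ℕ) (Msg : Type) : Type := Fin n × Option Msg

/-- An operation event: the invocation of an operation `o`, or the response of `o`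
with return value `v`. -/
inductive Event (Op Val : Type) : Type
  | inv (o : Op)
  | res (o : Op) (v : Val)
deriving DecidableEq

/-- The operation an event belongs to. -/
def Event.opOf {Op Val : Type} : Event Op Val → Op
  | .inv o => o
  | .res o _ => o

/-- A (deterministic) message-passing implementation for `n` processes, of an object
with operations `Op` returning values in `Val`.  In each step a process receives at
most one message, changes its local state via `trans`, and sends a finite list of
messages; invocations and responses of operations are encoded (via `eventOf`) as
changes of the state of the invoking process.  `procOf o` is the process that may
invoke operation `o`. -/
structure Impl (n : ℕ) (Op Val : Type) : Type 1 where
  Msg : Type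
  PState : Type
  init : Fin n → PState
  trans : Fin n → PState → Option Msg → PState × List (Fin n × Msg)
  eventOf : Fin n → PState → PState → Option (Event Op Val)
  procOf : Op → Fin n

variable {n : ℕ} {Op Val : Type}

/-- A configuration: the local states of all processes together with the message
buffer (the multiset of all messages sent but not yet received, tagged with their
destination process). -/
structure Config (I : Impl n Op Val) : Type where
  states : Fin n → I.PState
  buffer : Multiset (Fin n × I.Msg)

/-- The initial configuration: all processes in their initial states, empty buffer. -/
def initConfig (I : Impl n Op Val) : Config I :=
  ⟨I.init, 0⟩

/-- A step `(p, some m)` is applicable to `C` iff `m` is in the buffer for `p`;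
a step `(p, none)` is always applicable. -/
def Applicable (I : Impl n Op Val) (C : Config I) (e : Step n I.Msg) : Prop :=
  match e.2 with
  | none => True
  | some m => (e.1, m) ∈ C.buffer

open scoped Classical in
/-- The configuration resulting from applying step `e` to configuration `C`:
the stepping process changes state, the received message (if any) is removed from
the buffer, and the sent messages are added to it. -/
noncomputable def applyStep (I : Impl n Op Val) (C : Config I) (e : Step n I.Msg) :
    Config I :=
  { states := Function.update C.states e.1 (I.trans e.1 (C.states e.1) e.2).1
    buffer :=
      (match e.2 with
        | none => C.buffer
        | some m => C.buffer.erase (e.1, m))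
      + ((I.trans e.1 (C.states e.1) e.2).2 : Multiset (Fin n × I.Msg)) }

/-- A finite history (sequence of steps) `H` is applicable to `C` if each of its
steps is applicable in turn. -/
def ApplicableHist (I : Impl n Op Val) : Config I → List (Step n I.Msg) → Prop
  | _, [] => True
  | C, e :: H => Applicable I C e ∧ ApplicableHist I (applyStep I C e) H

/-- `H(C)`: the configuration obtained by applying the finite history `H` to `C`. -/
noncomputable def applyHist (I : Impl n Op Val) : Config I → List (Step n I.Msg) → Config I
  | C, [] => C
  | C, e :: H => applyHist I (applyStep I C e) H

/-- The event (if any) encoded by the state change of the process taking step `e`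
from configuration `C`. -/
noncomputable def stepEvent (I : Impl n Op Val) (C : Config I) (e : Step n I.Msg) :
    Option (Event Op Val) :=
  I.eventOf e.1 (C.states e.1) ((applyStep I C e).states e.1)

/-- The operation-level history (sequence of invocation/response events) of the run
in which `H` is applied to `C`. -/
noncomputable def runEvents (I : Impl n Op Val) :
    Config I → List (Step n I.Msg) → List (Event Op Val)
  | _, [] => []
  | C, e :: H => (stepEvent I C e).toList ++ runEvents I (applyStep I C e) H

/-- The set of (finite) histories of implementation `I`: all finite histories
applicable to the initial configuration.  (This set is prefix-closed.) -/
def Histories (I : Impl n Op Val) : Set (List (Step n I.Msg)) :=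
  {H | ApplicableHist I (initConfig I) H}

/-- The operation-level events of a history `H` of `I`. -/
noncomputable def events (I : Impl n Op Val) (H : List (Step n I.Msg)) :
    List (Event Op Val) :=
  runEvents I (initConfig I) H

/-- Operation `o` has been invoked in the event history `L`. -/
def Invoked (o : Op) (L : List (Event Op Val)) : Prop := Event.inv o ∈ L

/-- Operation `o` is complete in the event history `L`: `L` contains both its
invocation and a response for it. -/
def Completed (o : Op) (L : List (Event Op Val)) : Prop :=
  Event.inv o ∈ L ∧ ∃ v, Event.res o v ∈ L

/-- Operation `o` is pending in `L`: invoked but with no response. -/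
def Pending (o : Op) (L : List (Event Op Val)) : Prop :=
  Event.inv o ∈ L ∧ ∀ v, Event.res o v ∉ L

/-- `o` precedes `o'` in `L`: a response of `o` occurs (strictly) before the
invocation of `o'`. -/
def Precedes (L : List (Event Op Val)) (o o' : Op) : Prop :=
  ∃ (i j : ℕ) (hi : i < L.length) (hj : j < L.length),
    i < j ∧ (∃ v, L.get ⟨i, hi⟩ = Event.res o v) ∧ L.get ⟨j, hj⟩ = Event.inv o'

/-- A sequential event history: invocations immediately followed by their matching
responses, possibly ending with a single pending invocation (no two operations are
concurrent). -/
def Sequential : List (Event Op Val) → Prop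
  | [] => True
  | [Event.inv _] => True
  | Event.inv o :: Event.res o' _ :: L => o = o' ∧ Sequential L
  | _ => False

/-- `x` occurs at most once in the list `L`. -/
def AtMostOnce {β : Type _} (x : β) (L : List β) : Prop :=
  ∀ (i j : ℕ) (hi : i < L.length) (hj : j < L.length),
    L.get ⟨i, hi⟩ = x → L.get ⟨j, hj⟩ = x → i = j

/-- Operation `o` has at most one response event in `L`. -/
def AtMostOneRes (o : Op) (L : List (Event Op Val)) : Prop :=
  ∀ (i j : ℕ) (hi : i < L.length) (hj : j < L.length) (v v' : Val),
    L.get ⟨i, hi⟩ = Event.res o v → L.get ⟨j, hj⟩ = Event.res o v' → i = j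

/-- Well-formedness of an implementation: in every history, each operation is
invoked at most once, responds at most once, and responses follow invocations. -/
def WellFormed (I : Impl n Op Val) : Prop :=
  ∀ H ∈ Histories I,
    (∀ o : Op, AtMostOnce (Event.inv o) (events I H)) ∧
    (∀ o : Op, AtMostOneRes o (events I H)) ∧
    (∀ (o : Op) (v : Val), Event.res o v ∈ events I H → Event.inv o ∈ events I H)

/-- `L'` is a completion of the event history `L`: the events of a subset (`removed`)
of the pending operations of `L` are removed, and the remaining pending operations
are completed by appending responses `R` for them. -/
def IsCompletion (L L' : List (Event Op Val)) : Prop :=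
  ∃ (removed : Op → Bool) (R : List (Event Op Val)),
    (∀ o, removed o = true → Pending o L) ∧
    (∀ ev ∈ R, ∃ (o : Op) (v : Val), ev = Event.res o v ∧ Pending o L ∧ removed o = false) ∧
    (∀ o : Op, Pending o L → removed o = false → ∃ v, Event.res o v ∈ R) ∧
    (R.map Event.opOf).Nodup ∧
    L' = L.filter (fun ev => !removed ev.opOf) ++ R

/-- `f` is a linearization function for (the set of histories of) `I` with respect to
the sequential specification `Spec`: it maps each history `H` of `I` to a sequential
history `f H` that (1) has exactly the same operations (with the same responses) as
some completion of the events of `H`, (2) respects precedence, and (3) conforms to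
`Spec`. -/
def IsLinearizationFn (I : Impl n Op Val) (Spec : List (Event Op Val) → Prop)
    (f : List (Step n I.Msg) → List (Event Op Val)) : Prop :=
  ∀ H ∈ Histories I,
    Sequential (f H) ∧
    (∃ L', IsCompletion (events I H) L' ∧
      (∀ ev : Event Op Val, ev ∈ f H ↔ ev ∈ L') ∧
      (∀ o o' : Op, Precedes L' o o' → Precedes (f H) o o')) ∧
    Spec (f H)

/-- `I` is linearizable with respect to the sequential specification `Spec`. -/
def Linearizable (I : Impl n Op Val) (Spec : List (Event Op Val) → Prop) : Prop :=
  ∃ f, IsLinearizationFn I Spec f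

/-- `I` is strongly linearizable: there is a linearization function mapping
prefixes of histories to prefixes of their linearizations. -/
def StronglyLinearizable (I : Impl n Op Val) (Spec : List (Event Op Val) → Prop) : Prop :=
  ∃ f, IsLinearizationFn I Spec f ∧
    ∀ G H, G ∈ Histories I → H ∈ Histories I → G <+: H → f G <+: f H

/-- The finite history consisting of the first `k` steps of an infinite history `S`. -/
def prefixSteps {β : Type _} (S : ℕ → β) (k : ℕ) : List β :=
  (List.range k).map S

/-- The infinite history `S` is applicable to `C`: every step is applicable to the
configuration reached by the preceding steps. -/
def InfApplicable (I : Impl n Op Val) (C : Config I) (S : ℕ → Step n I.Msg) : Prop :=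
  ∀ k, Applicable I (applyHist I C (prefixSteps S k)) (S k)

/-- Process `p` is correct in the infinite history `S`: it takes infinitely many steps. -/
def CorrectProc {Msg : Type} (p : Fin n) (S : ℕ → Step n Msg) : Prop :=
  ∀ k, ∃ k' ≥ k, (S k').1 = p

/-- At most one process crashes (i.e., takes only finitely many steps) in `S`. -/
def AtMostOneCrash {Msg : Type} (S : ℕ → Step n Msg) : Prop :=
  ∀ p q : Fin n, ¬ CorrectProc p S → ¬ CorrectProc q S → p = q

/-- Every message sent to a correct process is eventually received. -/
def FairDelivery (I : Impl n Op Val) (C : Config I) (S : ℕ → Step n I.Msg) : Prop :=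
  ∀ (k : ℕ) (p : Fin n) (m : I.Msg), CorrectProc p S →
    (p, m) ∈ (applyHist I C (prefixSteps S k)).buffer →
    ∃ k' ≥ k, S k' = (p, some m)

/-- `I` is 1-resilient lock-free: for every reachable configuration (reached by a
history `H₀`) with a pending operation by process `p`, and every infinite history
applicable to it in which at most one process crashes, `p` is correct, and every
message sent to a correct process is eventually received, some finite prefix
completes an operation not yet complete. -/
def OneResilientLockFree (I : Impl n Op Val) : Prop :=
  ∀ H₀ ∈ Histories I, ∀ (p : Fin n) (o : Op),
    I.procOf o = p → Pending o (events I H₀) →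
    ∀ S : ℕ → Step n I.Msg,
      InfApplicable I (applyHist I (initConfig I) H₀) S →
      AtMostOneCrash S → CorrectProc p S →
      FairDelivery I (applyHist I (initConfig I) H₀) S →
      ∃ (k : ℕ) (o' : Op),
        Completed o' (events I (H₀ ++ prefixSteps S k)) ∧ ¬ Completed o' (events I H₀)

end MP

namespace MP

/-- The operations of a max-register (over natural numbers). -/
inductive MaxOp : Type
  | write (v : ℕ)
  | read
deriving DecidableEq

/-- Sequential specification of a max-register with initial value 0: every read
returns the maximum of the values written before it (0 if there is none). -/
def MaxSpec (L : List (Event MaxOp ℕ)) : Prop :=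
  ∀ (i : ℕ) (hi : i < L.length) (v : ℕ), L.get ⟨i, hi⟩ = Event.res MaxOp.read v →
    (∀ (j : ℕ) (hj : j < L.length), j < i →
      ∀ w : ℕ, L.get ⟨j, hj⟩ = Event.inv (MaxOp.write w) → w ≤ v) ∧
    (v = 0 ∨ ∃ (j : ℕ) (hj : j < L.length), j < i ∧ L.get ⟨j, hj⟩ = Event.inv (MaxOp.write v))

variable {n : ℕ}

/-- The system obtained by using a max-register implementation `I` as a Test-or-Set
object: the distinguished process `p0` invokes `read` once (as its first step), and the
distinguished process `p1 ≠ p0` invokes `write 1` once (as its first step); no other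
operation is ever invoked, and the other processes only help. -/
structure MaxAlg (I : Impl n MaxOp ℕ) (p0 p1 : Fin n) : Prop where
  distinct : p0 ≠ p1
  proc_read : I.procOf MaxOp.read = p0
  proc_write : ∀ w : ℕ, I.procOf (MaxOp.write w) = p1
  events_own : ∀ (p : Fin n) (s s' : I.PState) (ev : Event MaxOp ℕ),
    I.eventOf p s s' = some ev → I.procOf ev.opOf = p
  wellFormed : WellFormed I
  invokes_read : ∀ m : Option I.Msg,
    I.eventOf p0 (I.init p0) (I.trans p0 (I.init p0) m).1 = some (Event.inv MaxOp.read)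
  invokes_write : ∀ m : Option I.Msg,
    I.eventOf p1 (I.init p1) (I.trans p1 (I.init p1) m).1 = some (Event.inv (MaxOp.write 1))
  only_write_one : ∀ H ∈ Histories I, ∀ w : ℕ, Invoked (MaxOp.write w) (events I H) → w = 1

end MP

namespace MP

section Histories

variable {Op Val : Type} {I : Impl n Op Val}

/-- The configuration reached by the history `H` from the initial configuration. -/
noncomputable def conf (I : Impl n Op Val) (H : List (Step n I.Msg)) : Config I :=
  applyHist I (initConfig I) H

theorem applyHist_append (C : Config I) (G H : List (Step n I.Msg)) :
    applyHist I C (G ++ H) = applyHist I (applyHist I C G) H := by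
  induction G generalizing C with
  | nil => rfl
  | cons e G ih => exact ih _

theorem applicableHist_append (C : Config I) (G H : List (Step n I.Msg)) :
    ApplicableHist I C (G ++ H) ↔
      ApplicableHist I C G ∧ ApplicableHist I (applyHist I C G) H := by
  induction G generalizing C with
  | nil => simp [ApplicableHist, applyHist]
  | cons e G ih => simp only [List.cons_append, ApplicableHist, applyHist, ih, and_assoc]

theorem runEvents_append (C : Config I) (G H : List (Step n I.Msg)) :
    runEvents I C (G ++ H) = runEvents I C G ++ runEvents I (applyHist I C G) H := by
  induction G generalizing C with
  | nil => rfl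
  | cons e G ih => simp only [List.cons_append, runEvents, applyHist, ih, List.append_assoc]

theorem conf_append (G H : List (Step n I.Msg)) :
    conf I (G ++ H) = applyHist I (conf I G) H :=
  applyHist_append _ _ _

theorem append_mem_histories {G H : List (Step n I.Msg)} :
    G ++ H ∈ Histories I ↔ G ∈ Histories I ∧ ApplicableHist I (conf I G) H :=
  applicableHist_append _ _ _

theorem events_append (G H : List (Step n I.Msg)) :
    events I (G ++ H) = events I G ++ runEvents I (conf I G) H :=
  runEvents_append _ _ _

theorem mem_events_append {G : List (Step n I.Msg)} (H : List (Step n I.Msg))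
    {ev : Event Op Val} (h : ev ∈ events I G) : ev ∈ events I (G ++ H) := by
  rw [events_append]
  exact List.mem_append_left _ h

theorem Completed.append {G : List (Step n I.Msg)} {o : Op} (h : Completed o (events I G))
    (H : List (Step n I.Msg)) : Completed o (events I (G ++ H)) :=
  ⟨mem_events_append H h.1, h.2.imp fun _ => mem_events_append H⟩

theorem Pending.of_not_completed {L : List (Event Op Val)} {o : Op} (h : Invoked o L)
    (h' : ¬ Completed o L) : Pending o L :=
  ⟨h, fun v hv => h' ⟨h, v, hv⟩⟩

/-- A step stays applicable as long as it is not taken. -/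
theorem Applicable.applyStep_of_ne {C : Config I} {e e' : Step n I.Msg}
    (h : Applicable I C e) (hne : e ≠ e') : Applicable I (applyStep I C e') e := by
  obtain ⟨p, _ | m⟩ := e
  · trivial
  obtain ⟨q, _ | m'⟩ := e'
  · exact Multiset.mem_add.2 (Or.inl h)
  · refine Multiset.mem_add.2 (Or.inl ?_)
    classical
    refine (Multiset.mem_erase_of_ne fun h' => hne ?_).2 h
    cases h'
    rfl

theorem Applicable.applyHist_of_notMem {C : Config I} {e : Step n I.Msg}
    {H : List (Step n I.Msg)} (h : Applicable I C e) (he : e ∉ H) :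
    Applicable I (applyHist I C H) e := by
  induction H generalizing C with
  | nil => exact h
  | cons e' H ih =>
    simp only [List.mem_cons, not_or] at he
    exact ih (h.applyStep_of_ne he.1) he.2

theorem applyStep_comm {C : Config I} {e e' : Step n I.Msg} (hne : e.1 ≠ e'.1)
    (he : Applicable I C e) (he' : Applicable I C e') :
    applyStep I (applyStep I C e) e' = applyStep I (applyStep I C e') e := by
  classical
  obtain ⟨p, m⟩ := e
  obtain ⟨q, m'⟩ := e'
  simp only at hne
  simp only [applyStep, Function.update_of_ne hne, Function.update_of_ne hne.symm,
    Config.mk.injEq]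
  refine ⟨Function.update_comm hne _ _ _, ?_⟩
  rcases m with _ | m <;> rcases m' with _ | m'
  · exact add_right_comm _ _ _
  · simp only
    rw [Multiset.erase_add_left_pos _ he']
    exact add_right_comm _ _ _
  · simp only
    rw [Multiset.erase_add_left_pos _ he]
    exact add_right_comm _ _ _
  · have h1 : (q, m') ∈ C.buffer.erase (p, m) :=
      (Multiset.mem_erase_of_ne fun h => hne (congrArg Prod.fst h).symm).2 he'
    have h2 : (p, m) ∈ C.buffer.erase (q, m') :=
      (Multiset.mem_erase_of_ne fun h => hne (congrArg Prod.fst h)).2 he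
    simp only
    rw [Multiset.erase_add_left_pos _ h1, Multiset.erase_add_left_pos _ h2,
      Multiset.erase_comm]
    exact add_right_comm _ _ _

theorem stepEvent_applyStep_of_ne (C : Config I) {e e' : Step n I.Msg} (hne : e.1 ≠ e'.1) :
    stepEvent I (applyStep I C e) e' = stepEvent I C e' := by
  simp only [stepEvent, applyStep, Function.update_of_ne hne.symm, Function.update_self]

/-- A step of `p` commutes with a history in which `p` takes no step. -/
theorem cons_comm_of_forall_ne {C : Config I} {e : Step n I.Msg} {H : List (Step n I.Msg)}
    (he : Applicable I C e) (hH : ApplicableHist I C H) (hne : ∀ x ∈ H, x.1 ≠ e.1) :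
    ApplicableHist I C (e :: H) ∧ ApplicableHist I C (H ++ [e]) ∧
      applyHist I C (e :: H) = applyHist I C (H ++ [e]) ∧
      (runEvents I C (e :: H)).Perm (runEvents I C (H ++ [e])) := by
  induction H generalizing C with
  | nil => exact ⟨⟨he, trivial⟩, ⟨he, trivial⟩, rfl, List.Perm.refl _⟩
  | cons x H ih =>
    have hxe : x.1 ≠ e.1 := hne x List.mem_cons_self
    have hne' : x ≠ e := fun h => hxe (congrArg Prod.fst h)
    have he' := he.applyStep_of_ne hne'.symm
    have hx' := hH.1.applyStep_of_ne hne'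
    have hc := applyStep_comm hxe hH.1 he
    obtain ⟨h1, h2, h3, h4⟩ := ih he' hH.2 fun y hy => hne y (List.mem_cons_of_mem _ hy)
    refine ⟨⟨he, hx', ?_⟩, ⟨hH.1, h2⟩, ?_, ?_⟩
    · rw [← hc]
      exact h1.2
    · rw [List.cons_append]
      simp only [applyHist] at h3 ⊢
      rw [← hc, h3]
    · rw [List.cons_append]
      simp only [runEvents] at h4 ⊢
      rw [stepEvent_applyStep_of_ne _ hxe.symm, ← hc]
      rw [stepEvent_applyStep_of_ne _ hxe] at h4
      refine List.Perm.trans ?_ (h4.append_left _)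
      rw [← List.append_assoc, ← List.append_assoc]
      exact List.perm_append_comm.append_right _

/-- Histories that lead to the same configuration and contain the same events. -/
structure Indist (I : Impl n Op Val) (G H : List (Step n I.Msg)) : Prop where
  left_mem : G ∈ Histories I
  right_mem : H ∈ Histories I
  conf_eq : conf I G = conf I H
  perm : (events I G).Perm (events I H)

theorem Indist.symm {G H : List (Step n I.Msg)} (h : Indist I G H) : Indist I H G :=
  ⟨h.2, h.1, h.3.symm, h.4.symm⟩

theorem Indist.trans {G H K : List (Step n I.Msg)} (h : Indist I G H) (h' : Indist I H K) :
    Indist I G K :=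
  ⟨h.1, h'.2, h.3.trans h'.3, h.4.trans h'.4⟩

theorem Indist.append {G H : List (Step n I.Msg)} (h : Indist I G H)
    {σ : List (Step n I.Msg)} (hσ : G ++ σ ∈ Histories I) :
    Indist I (G ++ σ) (H ++ σ) := by
  have hσ' := (append_mem_histories.1 hσ).2
  refine ⟨hσ, append_mem_histories.2 ⟨h.2, h.3 ▸ hσ'⟩, ?_, ?_⟩
  · rw [conf_append, conf_append, h.3]
  · rw [events_append, events_append, h.3]
    exact h.4.append_right _

theorem indist_comm {G H : List (Step n I.Msg)} {e : Step n I.Msg}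
    (hG : G ++ H ∈ Histories I) (he : Applicable I (conf I G) e) (hne : ∀ x ∈ H, x.1 ≠ e.1) :
    Indist I (G ++ [e] ++ H) (G ++ H ++ [e]) := by
  rw [append_mem_histories] at hG
  obtain ⟨h1, h2, h3, h4⟩ := cons_comm_of_forall_ne he hG.2 hne
  rw [List.append_assoc, List.append_assoc]
  refine ⟨append_mem_histories.2 ⟨hG.1, h1⟩, append_mem_histories.2 ⟨hG.1, h2⟩, ?_, ?_⟩
  · rw [conf_append, conf_append]
    exact h3
  · rw [events_append, events_append]
    exact h4.append_left _

end Histories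

section Liveness

/-- The limit of a growing chain of lists. -/
theorem exists_limit_of_prefix_chain {β : Type*} (T : ℕ → List β)
    (hT : ∀ i, T i <+: T (i + 1)) (hlen : ∀ i, i ≤ (T i).length) :
    ∃ S : ℕ → β, ∀ i k (hk : k < (T i).length), S k = (T i)[k] := by
  have hmono : ∀ i j, i ≤ j → T i <+: T j := fun i j hij => by
    induction j, hij using Nat.le_induction with
    | base => exact List.prefix_rfl
    | succ j _ ih => exact ih.trans (hT j)
  refine ⟨fun k => (T (k + 1))[k]'(hlen (k + 1)), fun i k hk => ?_⟩
  rcases le_total i (k + 1) with h | h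
  · exact ((hmono _ _ h).getElem hk).symm
  · exact (hmono _ _ h).getElem _

theorem prefixSteps_eq_take {β : Type*} {S : ℕ → β} {L : List β}
    (h : ∀ k (hk : k < L.length), S k = L[k]) {k : ℕ} (hk : k ≤ L.length) :
    prefixSteps S k = L.take k := by
  apply List.ext_getElem
  · simp [prefixSteps, hk]
  · intro i h1 h2
    simp only [prefixSteps, List.getElem_map, List.getElem_range, List.getElem_take]
    exact h i _

theorem prefixSteps_succ {β : Type*} (S : ℕ → β) (k : ℕ) :
    prefixSteps S (k + 1) = prefixSteps S k ++ [S k] := by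
  simp [prefixSteps, List.range_succ]

variable {Op Val : Type} {I : Impl n Op Val}

theorem exists_extension_taking_steps {A : Fin n → Prop} {P : List (Step n I.Msg) → Prop}
    (hext : ∀ H e, P H → A e.1 → Applicable I (conf I H) e →
      ∃ σ, P (H ++ σ) ∧ (∀ x ∈ σ, A x.1) ∧ e ∈ σ)
    (L : List (Step n I.Msg)) {H : List (Step n I.Msg)} (hH : P H) :
    ∃ σ, P (H ++ σ) ∧ (∀ x ∈ σ, A x.1) ∧
      ∀ e ∈ L, A e.1 → Applicable I (conf I H) e → e ∈ σ := by
  induction L generalizing H with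
  | nil => exact ⟨[], by simpa using hH, by simp, by simp⟩
  | cons e L ih =>
    by_cases he : A e.1 ∧ Applicable I (conf I H) e
    · obtain ⟨σ, hσ, hσA, heσ⟩ := hext H e hH he.1 he.2
      obtain ⟨τ, hτ, hτA, hτL⟩ := ih hσ
      refine ⟨σ ++ τ, by rwa [← List.append_assoc], ?_, ?_⟩
      · intro x hx
        exact (List.mem_append.1 hx).elim (hσA x) (hτA x)
      · intro x hx hxA hxa
        rcases List.mem_cons.1 hx with rfl | hx
        · exact List.mem_append_left _ heσ
        · by_cases hxσ : x ∈ σ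
          · exact List.mem_append_left _ hxσ
          · refine List.mem_append_right _ (hτL x hx hxA ?_)
            rw [conf_append]
            exact hxa.applyHist_of_notMem hxσ
    · obtain ⟨τ, hτ, hτA, hτL⟩ := ih hH
      refine ⟨τ, hτ, hτA, fun x hx hxA hxa => ?_⟩
      rcases List.mem_cons.1 hx with rfl | hx
      · exact absurd ⟨hxA, hxa⟩ he
      · exact hτL x hx hxA hxa

theorem exists_extension_taking_all_steps {A : Fin n → Prop}
    {P : List (Step n I.Msg) → Prop}
    (hext : ∀ H e, P H → A e.1 → Applicable I (conf I H) e →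
      ∃ σ, P (H ++ σ) ∧ (∀ x ∈ σ, A x.1) ∧ e ∈ σ)
    {H : List (Step n I.Msg)} (hH : P H) :
    ∃ σ, P (H ++ σ) ∧ (∀ x ∈ σ, A x.1) ∧
      ∀ e, A e.1 → Applicable I (conf I H) e → e ∈ σ := by
  obtain ⟨σ, h1, h2, h3⟩ := exists_extension_taking_steps hext
    ((List.finRange n).map (fun p => (p, none)) ++
      (conf I H).buffer.toList.map (fun x => (x.1, some x.2))) hH
  refine ⟨σ, h1, h2, fun e hA he => h3 e ?_ hA he⟩
  obtain ⟨p, _ | m⟩ := e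
  · simp
  · refine List.mem_append_right _ (List.mem_map.2 ⟨(p, m), ?_, rfl⟩)
    exact Multiset.mem_toList.2 he

/-- If the histories satisfying `P` can be extended within `P` by taking any applicable step of a
process in `A`, and `A` misses at most one process, then from a history in `P` where a process in
`A` has a pending operation, some history in `P` completes a further operation: otherwise a fair
infinite history that contradicts lock-freedom could be assembled. -/
theorem exists_completing_extension (hlf : OneResilientLockFree I) (A : Fin n → Prop)
    (hA : ∀ p q, ¬ A p → ¬ A q → p = q) (P : List (Step n I.Msg) → Prop)
    (hP : ∀ H, P H → H ∈ Histories I)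
    (hext : ∀ H e, P H → A e.1 → Applicable I (conf I H) e →
      ∃ σ, P (H ++ σ) ∧ (∀ x ∈ σ, A x.1) ∧ e ∈ σ)
    {H : List (Step n I.Msg)} (hH : P H) (o : Op) (ho : A (I.procOf o))
    (hpend : Pending o (events I H)) :
    ∃ σ, P (H ++ σ) ∧ (∀ x ∈ σ, A x.1) ∧
      ∃ o', Completed o' (events I (H ++ σ)) ∧ ¬ Completed o' (events I H) := by
  choose! ext hextP hextA hextAll using
    fun G (hG : P G) => exists_extension_taking_all_steps hext hG
  let T : ℕ → List (Step n I.Msg) := fun i => Nat.rec [] (fun _ t => t ++ ext (H ++ t)) i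
  have hTs : ∀ i, T (i + 1) = T i ++ ext (H ++ T i) := fun _ => rfl
  have hTP : ∀ i, P (H ++ T i) := fun i => by
    induction i with
    | zero => simpa [T] using hH
    | succ i ih =>
      rw [hTs, ← List.append_assoc]
      exact hextP _ ih
  have hTA : ∀ i, ∀ x ∈ T i, A x.1 := fun i => by
    induction i with
    | zero => simp [T]
    | succ i ih =>
      intro x hx
      rw [hTs] at hx
      exact (List.mem_append.1 hx).elim (ih x) (hextA _ (hTP i) x)
  have hlen : ∀ i, i ≤ (T i).length := fun i => by
    induction i with
    | zero => simp
    | succ i ih =>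
      rw [hTs, List.length_append]
      have := List.length_pos_of_mem (hextAll _ (hTP i) (I.procOf o, none) ho trivial)
      omega
  obtain ⟨S, hS⟩ := exists_limit_of_prefix_chain T
    (fun i => hTs i ▸ List.prefix_append _ _) hlen
  have hpre : ∀ i k, k ≤ (T i).length → prefixSteps S k = (T i).take k :=
    fun i k hk => prefixSteps_eq_take (hS i) hk
  have hpreT : ∀ i, prefixSteps S (T i).length = T i := fun i => by
    rw [hpre i _ le_rfl, List.take_length]
  have hSA : ∀ k, A (S k).1 := fun k => by
    rw [hS (k + 1) k (hlen (k + 1))]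
    exact hTA (k + 1) _ (List.getElem_mem _)
  have hoccurs : ∀ i e, A e.1 → Applicable I (conf I (H ++ T i)) e → ∃ k ≥ i, S k = e := by
    intro i e he hea
    obtain ⟨j, hj, rfl⟩ := List.getElem_of_mem (hextAll _ (hTP i) e he hea)
    refine ⟨(T i).length + j, (hlen i).trans (Nat.le_add_right _ _), ?_⟩
    rw [hS (i + 1) _ (by rw [hTs, List.length_append]; omega)]
    simp [hTs]
  have hcorrect : ∀ p, A p → CorrectProc p S := fun p hp k => by
    obtain ⟨k', hk', h⟩ := hoccurs k (p, none) hp trivial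
    exact ⟨k', hk', by rw [h]⟩
  have happ : InfApplicable I (applyHist I (initConfig I) H) S := fun k => by
    have h := hP _ (hTP (k + 1))
    rw [← List.take_append_drop (k + 1) (T (k + 1)), ← hpre _ _ (hlen _), prefixSteps_succ,
      append_mem_histories, applicableHist_append, applicableHist_append] at h
    exact h.2.1.2.1
  have hfair : FairDelivery I (applyHist I (initConfig I) H) S := by
    intro k p m hp hm
    by_contra! hno
    have hstay : ∀ k' ≥ k,
        Applicable I (applyHist I (applyHist I (initConfig I) H) (prefixSteps S k'))
          (p, some m) := fun k' hk' => by
      induction k', hk' using Nat.le_induction with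
      | base => exact hm
      | succ j hj ih =>
        rw [prefixSteps_succ, applyHist_append]
        exact ih.applyStep_of_ne (hno j hj).symm
    obtain ⟨j, -, hj⟩ := hp 0
    have hpA : A p := hj ▸ hSA j
    have := hstay _ (hlen k)
    rw [hpreT, ← applyHist_append] at this
    obtain ⟨k', hk', h⟩ := hoccurs k (p, some m) hpA this
    exact hno k' hk' h
  obtain ⟨k, o', hc, hnc⟩ := hlf H (hP H hH) _ o rfl hpend S happ
    (fun p q hp hq => hA p q (fun h => hp (hcorrect p h)) (fun h => hq (hcorrect q h)))
    (hcorrect _ ho) hfair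
  refine ⟨T k, hTP k, hTA k, o', ?_, hnc⟩
  rw [hpre k k (hlen k)] at hc
  rw [← List.take_append_drop k (T k), ← List.append_assoc]
  exact hc.append _

end Liveness

section Linearization

variable {Op Val : Type} {I : Impl n Op Val} {Spec : List (Event Op Val) → Prop}
  {f : List (Step n I.Msg) → List (Event Op Val)} {H : List (Step n I.Msg)}

theorem IsLinearizationFn.inv_mem (hf : IsLinearizationFn I Spec f) (hH : H ∈ Histories I)
    {o : Op} (h : Event.inv o ∈ f H) : Event.inv o ∈ events I H := by
  obtain ⟨-, ⟨L', ⟨removed, R, -, hR, -, -, rfl⟩, hmem, -⟩, -⟩ := hf H hH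
  rcases List.mem_append.1 ((hmem _).1 h) with h | h
  · exact (List.mem_filter.1 h).1
  · obtain ⟨o', v, h, -⟩ := hR _ h
    cases h

theorem IsLinearizationFn.res_mem (hf : IsLinearizationFn I Spec f) (hH : H ∈ Histories I)
    {o : Op} {v : Val} (h : Event.res o v ∈ events I H) : Event.res o v ∈ f H := by
  obtain ⟨-, ⟨L', ⟨removed, R, hrem, -, -, -, rfl⟩, hmem, -⟩, -⟩ := hf H hH
  refine (hmem _).2 (List.mem_append_left _ (List.mem_filter.2 ⟨h, ?_⟩))
  by_contra hc
  exact (hrem o (by simpa [Event.opOf] using hc)).2 v h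

/-- A response in the linearization of an operation that has responded is a response of the
history. -/
theorem IsLinearizationFn.res_mem_events (hf : IsLinearizationFn I Spec f)
    (hH : H ∈ Histories I) {o : Op} {u v : Val} (h : Event.res o v ∈ f H)
    (hu : Event.res o u ∈ events I H) : Event.res o v ∈ events I H := by
  obtain ⟨-, ⟨L', ⟨removed, R, -, hR, -, -, rfl⟩, hmem, -⟩, -⟩ := hf H hH
  rcases List.mem_append.1 ((hmem _).1 h) with h | h
  · exact (List.mem_filter.1 h).1
  · obtain ⟨o', v', h, hp, -⟩ := hR _ h
    cases h
    exact absurd hu (hp.2 u)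

theorem IsLinearizationFn.ne_nil_of_completed (hf : IsLinearizationFn I Spec f)
    (hH : H ∈ Histories I) {o : Op} (h : Completed o (events I H)) : f H ≠ [] := by
  obtain ⟨-, v, hv⟩ := h
  exact List.ne_nil_of_mem (hf.res_mem hH hv)

theorem Sequential.exists_inv_cons {L : List (Event Op Val)} (h : Sequential L)
    (hne : L ≠ []) : ∃ o L', L = Event.inv o :: L' := by
  match L, h, hne with
  | Event.inv o :: L', _, _ => exact ⟨o, L', rfl⟩
  | Event.res _ _ :: _, h, _ => simp [Sequential] at h

theorem Sequential.exists_res_cons {L : List (Event Op Val)} {o : Op}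
    (h : Sequential (Event.inv o :: L)) (hne : L ≠ []) :
    ∃ v L', L = Event.res o v :: L' := by
  match L, h, hne with
  | Event.inv _ :: _, h, _ => simp [Sequential] at h
  | Event.res o' v :: L', h, _ =>
    obtain ⟨rfl, -⟩ := h
    exact ⟨v, L', rfl⟩

theorem WellFormed.res_unique (hI : WellFormed I) (hH : H ∈ Histories I) {o : Op} {u v : Val}
    (hu : Event.res o u ∈ events I H) (hv : Event.res o v ∈ events I H) : u = v := by
  obtain ⟨i, hi, hiu⟩ := List.getElem_of_mem hu
  obtain ⟨j, hj, hjv⟩ := List.getElem_of_mem hv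
  obtain rfl := (hI H hH).2.1 o i j hi hj u v hiu hjv
  have := hiu.symm.trans hjv
  cases this
  rfl

end Linearization

section MaxRegister

variable {I : Impl n MaxOp ℕ} {p0 p1 : Fin n}
  {f : List (Step n I.Msg) → List (Event MaxOp ℕ)} {G H : List (Step n I.Msg)}

/-- Once the write is linearized first, the read can only return `1`. -/
theorem read_eq_one_of_write_first (hI : MaxAlg I p0 p1)
    (hf : IsLinearizationFn I MaxSpec f) (hH : H ∈ Histories I)
    (hpre : [Event.inv (MaxOp.write 1)] <+: f H) {u : ℕ}
    (hu : Event.res MaxOp.read u ∈ events I H) : u = 1 := by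
  obtain ⟨L, hL⟩ := hpre
  have hspec := (hf H hH).2.2
  obtain ⟨i, hi, hiu⟩ := List.getElem_of_mem (hf.res_mem hH hu)
  obtain ⟨h1, h2⟩ := hspec i hi u hiu
  have h0 : (f H)[0]'(by omega) = Event.inv (MaxOp.write 1) := by simp [← hL]
  have hi0 : 0 < i := by
    rcases Nat.eq_zero_or_pos i with rfl | h
    · rw [h0] at hiu
      cases hiu
    · exact h
  have hle : 1 ≤ u := h1 0 (by omega) hi0 1 h0
  rcases h2 with rfl | ⟨j, hj, -, hju⟩
  · omega
  · exact hI.only_write_one H hH u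
      (hf.inv_mem hH (List.mem_of_getElem (h := hj) hju))

/-- Once the read is linearized first, it can only return `0`. -/
theorem read_eq_zero_of_read_first (hI : MaxAlg I p0 p1)
    (hf : IsLinearizationFn I MaxSpec f) (hH : H ∈ Histories I)
    (hpre : [Event.inv MaxOp.read] <+: f H) {u : ℕ}
    (hu : Event.res MaxOp.read u ∈ events I H) : u = 0 := by
  obtain ⟨L, hL⟩ := hpre
  obtain ⟨hseq, -, hspec⟩ := hf H hH
  have hmem := hf.res_mem hH hu
  have hLne : L ≠ [] := by
    rintro rfl
    simp [← hL] at hmem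
  rw [← hL] at hseq
  obtain ⟨v, L', rfl⟩ := hseq.exists_res_cons hLne
  have hv : Event.res MaxOp.read v ∈ f H := by simp [← hL]
  obtain rfl : u = v :=
    hI.wellFormed.res_unique hH hu (hf.res_mem_events hH hv hu)
  have hlen : 1 < (f H).length := by simp [← hL]
  obtain ⟨-, rfl | ⟨j, hj, hj1, hju⟩⟩ := hspec 1 hlen u (by simp [← hL])
  · rfl
  · obtain rfl : j = 0 := by omega
    simp [← hL] at hju

theorem op_eq_of_invoked (hI : MaxAlg I p0 p1) (hH : H ∈ Histories I) {o : MaxOp}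
    (ho : Invoked o (events I H)) : o = MaxOp.read ∨ o = MaxOp.write 1 := by
  cases o with
  | read => exact Or.inl rfl
  | write w => exact Or.inr (by rw [hI.only_write_one H hH w ho])

/-- The first operation in the linearization determines the value that the read can return. -/
theorem exists_read_value (hI : MaxAlg I p0 p1) (hf : IsLinearizationFn I MaxSpec f)
    (hpre : ∀ G H, G ∈ Histories I → H ∈ Histories I → G <+: H → f G <+: f H)
    (hH : H ∈ Histories I) (hne : f H ≠ []) :
    (Invoked MaxOp.read (events I H) ∧ ∀ σ, H ++ σ ∈ Histories I →
        ∀ u, Event.res MaxOp.read u ∈ events I (H ++ σ) → u = 0) ∨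
      (Invoked (MaxOp.write 1) (events I H) ∧ ∀ σ, H ++ σ ∈ Histories I →
        ∀ u, Event.res MaxOp.read u ∈ events I (H ++ σ) → u = 1) := by
  obtain ⟨o, L, hL⟩ := (hf H hH).1.exists_inv_cons hne
  have hinv : Invoked o (events I H) := hf.inv_mem hH (by simp [hL])
  have hpre' : ∀ σ, H ++ σ ∈ Histories I → [Event.inv o] <+: f (H ++ σ) := fun σ hσ =>
    List.IsPrefix.trans ⟨L, by simp [hL]⟩ (hpre H _ hH hσ (List.prefix_append _ _))
  rcases op_eq_of_invoked hI hH hinv with rfl | rfl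
  · exact Or.inl ⟨hinv, fun σ hσ u => read_eq_zero_of_read_first hI hf hσ (hpre' σ hσ)⟩
  · exact Or.inr ⟨hinv, fun σ hσ u => read_eq_one_of_write_first hI hf hσ (hpre' σ hσ)⟩

/-- An event produced in a run belongs to an operation of a process that takes a step in it. -/
theorem exists_step_of_mem_runEvents (hI : MaxAlg I p0 p1) {C : Config I}
    {ev : Event MaxOp ℕ} (h : ev ∈ runEvents I C H) : ∃ e ∈ H, e.1 = I.procOf ev.opOf := by
  induction H generalizing C with
  | nil => simp [runEvents] at h
  | cons e H ih =>
    simp only [runEvents, List.mem_append, Option.mem_toList] at h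
    rcases h with h | h
    · exact ⟨e, List.mem_cons_self, (hI.events_own _ _ _ _ h).symm⟩
    · obtain ⟨e', he', h'⟩ := ih h
      exact ⟨e', List.mem_cons_of_mem _ he', h'⟩

theorem invoked_after_first_step (hI : MaxAlg I p0 p1) {o : MaxOp}
    (ho : o = MaxOp.read ∨ o = MaxOp.write 1) (m : Option I.Msg) :
    I.eventOf (I.procOf o) (I.init (I.procOf o))
      (I.trans (I.procOf o) (I.init (I.procOf o)) m).1 = some (Event.inv o) := by
  rcases ho with rfl | rfl
  · rw [hI.proc_read]
    exact hI.invokes_read m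
  · rw [hI.proc_write]
    exact hI.invokes_write m

theorem invoked_append_singleton_of_init (hI : MaxAlg I p0 p1) {o : MaxOp}
    (ho : o = MaxOp.read ∨ o = MaxOp.write 1)
    (hinit : (conf I H).states (I.procOf o) = I.init (I.procOf o)) (m : Option I.Msg) :
    Invoked o (events I (H ++ [(I.procOf o, m)])) := by
  rw [Invoked, events_append]
  refine List.mem_append_right _ ?_
  simp [runEvents, stepEvent, applyStep, hinit, invoked_after_first_step hI ho m]

theorem invoked_or_state_eq_init (hI : MaxAlg I p0 p1) {o : MaxOp}
    (ho : o = MaxOp.read ∨ o = MaxOp.write 1) (H : List (Step n I.Msg)) :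
    Invoked o (events I H) ∨ (conf I H).states (I.procOf o) = I.init (I.procOf o) := by
  induction H using List.reverseRecOn with
  | nil => exact Or.inr rfl
  | append_singleton H e ih =>
    rcases ih with h | h
    · exact Or.inl (mem_events_append _ h)
    · obtain ⟨p, m⟩ := e
      by_cases hp : p = I.procOf o
      · subst hp
        exact Or.inl (invoked_append_singleton_of_init hI ho h m)
      · refine Or.inr ?_
        rw [conf_append]
        simp only [applyHist, applyStep]
        rw [Function.update_of_ne (Ne.symm hp), h]

theorem invoked_append_singleton (hI : MaxAlg I p0 p1) {o : MaxOp}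
    (ho : o = MaxOp.read ∨ o = MaxOp.write 1) (H : List (Step n I.Msg)) (m : Option I.Msg) :
    Invoked o (events I (H ++ [(I.procOf o, m)])) := by
  rcases invoked_or_state_eq_init hI ho H with h | h
  · exact mem_events_append _ h
  · exact invoked_append_singleton_of_init hI ho h m

theorem append_singleton_mem_histories {e : Step n I.Msg} (hH : H ∈ Histories I)
    (he : Applicable I (conf I H) e) : H ++ [e] ∈ Histories I :=
  append_mem_histories.2 ⟨hH, he, trivial⟩

/-- If a process other than `q` has a pending operation, then some further operation can be
completed without any step of `q`. -/
theorem exists_completing_extension_avoiding (hlf : OneResilientLockFree I)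
    (hH : H ∈ Histories I) {q : Fin n} {o : MaxOp} (hq : I.procOf o ≠ q)
    (hpend : Pending o (events I H)) :
    ∃ σ, H ++ σ ∈ Histories I ∧ (∀ x ∈ σ, x.1 ≠ q) ∧
      ∃ o', Completed o' (events I (H ++ σ)) ∧ ¬ Completed o' (events I H) :=
  exists_completing_extension hlf (fun p => p ≠ q)
    (fun a b ha hb => (not_not.1 ha).trans (not_not.1 hb).symm) (· ∈ Histories I)
    (fun _ h => h)
    (fun _ e hG he hea => ⟨[e], append_singleton_mem_histories hG hea,
      by simpa using he, List.mem_singleton_self e⟩)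
    hH o hq hpend

/-- Every operation can be completed without any step of a given other process. -/
theorem exists_extension_completed (hI : MaxAlg I p0 p1) (hlf : OneResilientLockFree I)
    (hH : H ∈ Histories I) {q : Fin n} {o : MaxOp}
    (ho : o = MaxOp.read ∨ o = MaxOp.write 1) (hq : I.procOf o ≠ q) :
    ∃ σ, H ++ σ ∈ Histories I ∧ (∀ x ∈ σ, x.1 ≠ q) ∧ Completed o (events I (H ++ σ)) := by
  set e : Step n I.Msg := (I.procOf o, none)
  have hH1 : H ++ [e] ∈ Histories I := append_singleton_mem_histories hH trivial
  have hinv : Invoked o (events I (H ++ [e])) := invoked_append_singleton hI ho H none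
  have he : ∀ x ∈ [e], x.1 ≠ q := by simpa using hq
  by_cases h1 : Completed o (events I (H ++ [e]))
  · exact ⟨_, hH1, he, h1⟩
  obtain ⟨σ, hσ, hσq, a, ha, ha'⟩ :=
    exists_completing_extension_avoiding hlf hH1 hq (.of_not_completed hinv h1)
  have hσq' : ∀ x ∈ [e] ++ σ, x.1 ≠ q := List.forall_mem_append.2 ⟨he, hσq⟩
  by_cases h2 : Completed o (events I (H ++ [e] ++ σ))
  · exact ⟨[e] ++ σ, by rwa [← List.append_assoc], hσq', by rwa [← List.append_assoc]⟩
  obtain ⟨τ, hτ, hτq, b, hb, hb'⟩ := exists_completing_extension_avoiding hlf hσ hq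
    (.of_not_completed (mem_events_append _ hinv) h2)
  refine ⟨[e] ++ σ ++ τ, by rwa [← List.append_assoc, ← List.append_assoc],
    List.forall_mem_append.2 ⟨hσq', hτq⟩, ?_⟩
  rw [← List.append_assoc, ← List.append_assoc]
  have hao : a ≠ o := fun h => h2 (h ▸ ha)
  have hab : a ≠ b := fun h => hb' (h ▸ ha)
  have hbo : b = o := by
    rcases op_eq_of_invoked hI hσ ha.1 with h | h <;>
    rcases op_eq_of_invoked hI hτ hb.1 with h' | h' <;>
    rcases ho with h'' | h'' <;> simp_all
  exact hbo ▸ hb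

/-- The read returns `v` in some extension of the history `H`. -/
def CanRead (I : Impl n MaxOp ℕ) (v : ℕ) (H : List (Step n I.Msg)) : Prop :=
  ∃ σ, H ++ σ ∈ Histories I ∧ Event.res MaxOp.read v ∈ events I (H ++ σ)

theorem CanRead.mem {v : ℕ} (h : CanRead I v H) : H ∈ Histories I := by
  obtain ⟨σ, hσ, -⟩ := h
  exact (append_mem_histories.1 hσ).1

theorem CanRead.of_append {v : ℕ} {σ : List (Step n I.Msg)} (h : CanRead I v (H ++ σ)) :
    CanRead I v H := by
  obtain ⟨τ, hτ, hv⟩ := h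
  rw [List.append_assoc] at hτ hv
  exact ⟨σ ++ τ, hτ, hv⟩

theorem CanRead.of_indist {v : ℕ} (h : CanRead I v G) (hGH : Indist I G H) :
    CanRead I v H := by
  obtain ⟨σ, hσ, hv⟩ := h
  have hσ' := hGH.append hσ
  exact ⟨σ, hσ'.right_mem, hσ'.perm.mem_iff.1 hv⟩

theorem CanRead.eq_zero_or_one {v : ℕ} (h : CanRead I v H) (hI : MaxAlg I p0 p1)
    (hf : IsLinearizationFn I MaxSpec f)
    (hpre : ∀ G H, G ∈ Histories I → H ∈ Histories I → G <+: H → f G <+: f H) :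
    v = 0 ∨ v = 1 := by
  obtain ⟨σ, hσ, hv⟩ := h
  rw [← List.append_nil (H ++ σ)] at hσ hv
  have hσ' := (append_mem_histories.1 hσ).1
  have hne : f (H ++ σ) ≠ [] :=
    List.ne_nil_of_mem (hf.res_mem hσ' (by simpa using hv))
  exact (exists_read_value hI hf hpre hσ' hne).imp (fun h => h.2 [] hσ v hv)
    (fun h => h.2 [] hσ v hv)

theorem canRead_zero_or_one (hI : MaxAlg I p0 p1) (hlf : OneResilientLockFree I)
    (hf : IsLinearizationFn I MaxSpec f)
    (hpre : ∀ G H, G ∈ Histories I → H ∈ Histories I → G <+: H → f G <+: f H)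
    (hH : H ∈ Histories I) : CanRead I 0 H ∨ CanRead I 1 H := by
  obtain ⟨σ, hσ, -, hc⟩ := exists_extension_completed hI hlf hH (q := p1) (Or.inl rfl)
    (hI.proc_read ▸ hI.distinct)
  obtain ⟨-, v, hv⟩ := hc
  have hcan : CanRead I v H := ⟨σ, hσ, hv⟩
  rcases hcan.eq_zero_or_one hI hf hpre with rfl | rfl
  · exact Or.inl hcan
  · exact Or.inr hcan

/-- Both return values of the read are still possible. -/
def Bivalent (I : Impl n MaxOp ℕ) (H : List (Step n I.Msg)) : Prop :=
  CanRead I 0 H ∧ CanRead I 1 H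

theorem Bivalent.linearization_eq_nil (hH : Bivalent I H) (hI : MaxAlg I p0 p1)
    (hf : IsLinearizationFn I MaxSpec f)
    (hpre : ∀ G H, G ∈ Histories I → H ∈ Histories I → G <+: H → f G <+: f H) :
    f H = [] := by
  by_contra hne
  obtain ⟨⟨σ, hσ, hv⟩, ⟨τ, hτ, hw⟩⟩ := id hH
  rcases exists_read_value hI hf hpre hH.1.mem hne with ⟨-, h⟩ | ⟨-, h⟩
  · exact absurd (h _ hτ _ hw) (by decide)
  · exact absurd (h _ hσ _ hv) (by decide)

theorem not_invoked_of_forall_ne (hI : MaxAlg I p0 p1) {o : MaxOp}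
    (h : ∀ x ∈ H, x.1 ≠ I.procOf o) : ¬ Invoked o (events I H) := fun ho => by
  obtain ⟨e, he, heo⟩ := exists_step_of_mem_runEvents hI ho
  exact h e he heo

theorem bivalent_nil (hI : MaxAlg I p0 p1) (hlf : OneResilientLockFree I)
    (hf : IsLinearizationFn I MaxSpec f)
    (hpre : ∀ G H, G ∈ Histories I → H ∈ Histories I → G <+: H → f G <+: f H) :
    Bivalent I [] := by
  have hnil : [] ∈ Histories I := trivial
  constructor
  · obtain ⟨σ, hσ, hσq, hc⟩ := exists_extension_completed hI hlf hnil (q := p1) (Or.inl rfl)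
      (hI.proc_read ▸ hI.distinct)
    rw [List.nil_append] at hσ hc
    have hw : ¬ Invoked (MaxOp.write 1) (events I σ) :=
      not_invoked_of_forall_ne hI (by rwa [hI.proc_write])
    rcases exists_read_value hI hf hpre hσ (hf.ne_nil_of_completed hσ hc) with h | h
    · refine CanRead.of_append (σ := σ) ?_
      rcases canRead_zero_or_one hI hlf hf hpre hσ with h' | ⟨τ, hτ, hv⟩
      · exact h'
      · exact absurd (h.2 τ hτ 1 hv) one_ne_zero
    · exact absurd h.1 hw
  · obtain ⟨σ, hσ, hσq, hc⟩ := exists_extension_completed hI hlf hnil (q := p0) (Or.inr rfl)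
      (hI.proc_write 1 ▸ hI.distinct.symm)
    rw [List.nil_append] at hσ hc
    have hr : ¬ Invoked MaxOp.read (events I σ) :=
      not_invoked_of_forall_ne hI (by rwa [hI.proc_read])
    rcases exists_read_value hI hf hpre hσ (hf.ne_nil_of_completed hσ hc) with h | h
    · exact absurd h.1 hr
    · refine CanRead.of_append (σ := σ) ?_
      rcases canRead_zero_or_one hI hlf hf hpre hσ with ⟨τ, hτ, hv⟩ | hcan
      · exact absurd (h.2 τ hτ 0 hv) zero_ne_one
      · exact hcan

/-- Two steps of the same process applied after `H` do not decide differently: the other processes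
can complete an operation, and hence fix the value of the read, before noticing them. -/
theorem exists_canRead_of_same_process (hI : MaxAlg I p0 p1) (hlf : OneResilientLockFree I)
    (hf : IsLinearizationFn I MaxSpec f)
    (hpre : ∀ G H, G ∈ Histories I → H ∈ Histories I → G <+: H → f G <+: f H)
    {e e' : Step n I.Msg} (hproc : e'.1 = e.1) (hH : H ∈ Histories I)
    (he : Applicable I (conf I H) e) (he' : Applicable I (conf I H) e')
    (hee' : Applicable I (conf I (H ++ [e'])) e) :
    ∃ v, CanRead I v (H ++ [e]) ∧ CanRead I v (H ++ [e'] ++ [e]) := by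
  obtain ⟨τ, hτ, hτe, o, hc⟩ : ∃ τ, H ++ τ ∈ Histories I ∧ (∀ x ∈ τ, x.1 ≠ e.1) ∧
      ∃ o, Completed o (events I (H ++ τ)) := by
    by_cases h : p0 = e.1
    · obtain ⟨τ, h1, h2, h3⟩ := exists_extension_completed hI hlf hH (q := e.1) (Or.inr rfl)
        (hI.proc_write 1 ▸ h ▸ hI.distinct.symm)
      exact ⟨τ, h1, h2, _, h3⟩
    · obtain ⟨τ, h1, h2, h3⟩ := exists_extension_completed hI hlf hH (q := e.1) (Or.inl rfl)
        (hI.proc_read ▸ h)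
      exact ⟨τ, h1, h2, _, h3⟩
  have hi1 : Indist I (H ++ [e] ++ τ) (H ++ τ ++ [e]) := indist_comm hτ he hτe
  have hi2 : Indist I (H ++ [e'] ++ τ) (H ++ τ ++ [e']) :=
    indist_comm hτ he' (by rwa [hproc])
  have hi3 : Indist I (H ++ [e'] ++ [e] ++ τ) (H ++ [e'] ++ τ ++ [e]) :=
    indist_comm hi2.left_mem hee' hτe
  have hi4 : Indist I (H ++ [e'] ++ [e] ++ τ) (H ++ τ ++ [e'] ++ [e]) :=
    hi3.trans (hi2.append hi3.right_mem)
  obtain ⟨v, hv⟩ : ∃ v, ∀ σ, H ++ τ ++ σ ∈ Histories I → CanRead I v (H ++ τ ++ σ) := by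
    rcases exists_read_value hI hf hpre hτ (hf.ne_nil_of_completed hτ hc) with ⟨-, h⟩ | ⟨-, h⟩
    · refine ⟨0, fun σ hσ => (canRead_zero_or_one hI hlf hf hpre hσ).resolve_right ?_⟩
      rintro ⟨ρ, hρ, hv⟩
      rw [List.append_assoc] at hρ hv
      exact absurd (h _ hρ _ hv) one_ne_zero
    · refine ⟨1, fun σ hσ => (canRead_zero_or_one hI hlf hf hpre hσ).resolve_left ?_⟩
      rintro ⟨ρ, hρ, hv⟩
      rw [List.append_assoc] at hρ hv
      exact absurd (h _ hρ _ hv) zero_ne_one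
  refine ⟨v, ((hv [e] hi1.right_mem).of_indist hi1.symm).of_append, ?_⟩
  have h4 := hi4.right_mem
  have h4' := hi4.symm
  rw [List.append_assoc (H ++ τ)] at h4 h4'
  exact ((hv _ h4).of_indist h4').of_append

/-- Inserting a step `e'` before a step `e` cannot turn one univalent history into one of the
other value. -/
theorem exists_canRead_of_ne (hI : MaxAlg I p0 p1) (hlf : OneResilientLockFree I)
    (hf : IsLinearizationFn I MaxSpec f)
    (hpre : ∀ G H, G ∈ Histories I → H ∈ Histories I → G <+: H → f G <+: f H)
    {e e' : Step n I.Msg} (hne : e ≠ e') (he : Applicable I (conf I H) e)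
    (hH : H ++ [e'] ∈ Histories I) :
    ∃ v, CanRead I v (H ++ [e]) ∧ CanRead I v (H ++ [e'] ++ [e]) := by
  obtain ⟨hH0, he', -⟩ := append_mem_histories.1 hH
  have hee' : Applicable I (conf I (H ++ [e'])) e := by
    rw [conf_append]
    exact he.applyStep_of_ne hne
  by_cases hproc : e'.1 = e.1
  · exact exists_canRead_of_same_process hI hlf hf hpre hproc hH0 he he' hee'
  · have hi : Indist I (H ++ [e] ++ [e']) (H ++ [e'] ++ [e]) :=
      indist_comm hH he (by simpa using hproc)
    rcases canRead_zero_or_one hI hlf hf hpre hi.left_mem with h | h <;>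
      exact ⟨_, h.of_append, h.of_indist hi⟩

/-- A bivalent history can be extended to a bivalent history that ends with a given applicable
step. -/
theorem exists_bivalent_extension (hI : MaxAlg I p0 p1) (hlf : OneResilientLockFree I)
    (hf : IsLinearizationFn I MaxSpec f)
    (hpre : ∀ G H, G ∈ Histories I → H ∈ Histories I → G <+: H → f G <+: f H)
    (hH : Bivalent I H) {e : Step n I.Msg} (he : Applicable I (conf I H) e) :
    ∃ σ, Bivalent I (H ++ σ ++ [e]) := by
  by_contra! hno
  have hreach : ∀ v, CanRead I v H → ∃ σ, e ∉ σ ∧ H ++ σ ∈ Histories I ∧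
      CanRead I v (H ++ σ ++ [e]) := by
    rintro v ⟨σ, hσ, hv⟩
    by_cases heσ : e ∈ σ
    · obtain ⟨s, t, rfl, hs⟩ := List.eq_append_cons_of_mem heσ
      have hc : CanRead I v (H ++ s ++ [e]) := ⟨t, by simpa using hσ, by simpa using hv⟩
      exact ⟨s, hs, (append_mem_histories.1 hc.mem).1, hc⟩
    · refine ⟨σ, heσ, hσ, [], ?_, ?_⟩
      · rw [List.append_nil]
        refine append_singleton_mem_histories hσ ?_
        rw [conf_append]
        exact he.applyHist_of_notMem heσ
      · rw [List.append_nil]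
        exact mem_events_append _ hv
  have huniv : ∀ σ v w, CanRead I v (H ++ σ ++ [e]) → CanRead I w (H ++ σ ++ [e]) → v = w := by
    intro σ v w hv hw
    rcases hv.eq_zero_or_one hI hf hpre with rfl | rfl <;>
      rcases hw.eq_zero_or_one hI hf hpre with rfl | rfl
    · rfl
    · exact absurd ⟨hv, hw⟩ (hno σ)
    · exact absurd ⟨hw, hv⟩ (hno σ)
    · rfl
  have hconst : ∀ v, CanRead I v (H ++ [e]) → ∀ σ, e ∉ σ → H ++ σ ∈ Histories I →
      CanRead I v (H ++ σ ++ [e]) := by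
    intro v hv σ
    induction σ using List.reverseRecOn with
    | nil => simpa using fun _ => hv
    | append_singleton σ e' ih =>
      intro heσ hσ
      simp only [List.mem_append, List.mem_singleton, not_or] at heσ
      rw [← List.append_assoc] at hσ ⊢
      have he' : Applicable I (conf I (H ++ σ)) e := by
        rw [conf_append]
        exact he.applyHist_of_notMem heσ.1
      obtain ⟨u, hu, hu'⟩ := exists_canRead_of_ne hI hlf hf hpre heσ.2 he' hσ
      obtain rfl := huniv σ v u (ih heσ.1 (append_mem_histories.1 hσ).1) hu
      exact hu'
  obtain ⟨s, hes, hs, hs0⟩ := hreach 0 hH.1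
  obtain ⟨t, het, ht, ht1⟩ := hreach 1 hH.2
  rcases canRead_zero_or_one hI hlf hf hpre
    (append_singleton_mem_histories hH.1.mem he) with h | h
  · exact absurd (huniv t 0 1 (hconst 0 h t het ht) ht1) zero_ne_one
  · exact absurd (huniv s 0 1 hs0 (hconst 1 h s hes hs)) zero_ne_one

end MaxRegister


/-- **Corollary (max-registers).** For all `n ≥ 2`, there is no 1-resilient lock-free
strongly linearizable implementation of a max-register in an asynchronous
message-passing system of `n` processes. -/
theorem no_oneResilient_lockFree_stronglyLinearizable_maxRegister (n : ℕ) (hn : 2 ≤ n) :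
    ¬ ∃ (I : Impl n MaxOp ℕ) (p0 p1 : Fin n),
        MaxAlg I p0 p1 ∧ OneResilientLockFree I ∧ StronglyLinearizable I MaxSpec := by
  rintro ⟨I, p0, p1, hI, hlf, f, hf, hpre⟩
  have hnone : ∀ H, Bivalent I H → ∀ o, ¬ Completed o (events I H) := fun H hH o ho =>
    hf.ne_nil_of_completed hH.1.mem ho (hH.linearization_eq_nil hI hf hpre)
  obtain ⟨σ, hσ⟩ := exists_bivalent_extension hI hlf hf hpre (bivalent_nil hI hlf hf hpre)
    (e := (I.procOf MaxOp.read, none)) trivial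
  have hpend := Pending.of_not_completed
    (invoked_append_singleton hI (Or.inl rfl) ([] ++ σ) none) (hnone _ hσ _)
  obtain ⟨τ, hτ, -, o, ho, -⟩ := exists_completing_extension hlf (fun _ => True)
    (fun p q h => absurd trivial h) (Bivalent I) (fun H h => h.1.mem)
    (fun H e hH _ he => by
      obtain ⟨ρ, hρ⟩ := exists_bivalent_extension hI hlf hf hpre hH he
      exact ⟨ρ ++ [e], by rwa [← List.append_assoc], fun _ _ => trivial, by simp⟩)
    hσ MaxOp.read trivial hpend
  exact hnone _ hτ o ho


end MP
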